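/- Let G be a minimally imperfect graph with a skew partition A, B, C, D. If some vertex u ∈ A has no neighbor in C, then every vertex of A has a neighbor in D and every vertex of B has a neighbor in C. -/

import Mathlib

open SimpleGraph

/-- A graph is perfect if, in every induced subgraph, the clique number equals
the chromatic number. -/
def IsPerfect {V : Type*} (G : SimpleGraph V) : Prop :=
  ∀ S : Set V, ((G.induce S).cliqueNum : ℕ∞) = (G.induce S).chromaticNumber

/-- A graph is minimally imperfect if it is not perfect but every proper induced
subgraph of it is perfect. -/
def MinimallyImperfect {V : Type*} (G : SimpleGraph V) : Prop :=
  ¬ IsPerfect G ∧ ∀ S : Set V, S ≠ Set.univ → IsPerfect (G.induce S)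

/-- `A, B, C, D` form a skew partition of `G`: all four sets are nonempty, they
partition the vertex set, every vertex of `A` is adjacent to every vertex of `B`,
and there are no edges between `C` and `D`. -/
def IsSkewPartition {V : Type*} (G : SimpleGraph V) (A B C D : Set V) : Prop :=
  A.Nonempty ∧ B.Nonempty ∧ C.Nonempty ∧ D.Nonempty ∧
  A ∪ B ∪ C ∪ D = Set.univ ∧
  Disjoint A B ∧ Disjoint A C ∧ Disjoint A D ∧
  Disjoint B C ∧ Disjoint B D ∧ Disjoint C D ∧
  (∀ a ∈ A, ∀ b ∈ B, G.Adj a b) ∧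
  (∀ c ∈ C, ∀ d ∈ D, ¬ G.Adj c d)

/-- A graph has a skew partition if its vertex set admits one. -/
def HasSkewPartition {V : Type*} (G : SimpleGraph V) : Prop :=
  ∃ A B C D : Set V, IsSkewPartition G A B C D

/-- Every set `S ⊆ T` whose cliques have at most `m` vertices can be properly coloured with the
colours `0, …, m - 1`. -/
def HereditarilyColorable {V : Type*} (G : SimpleGraph V) (T : Set V) : Prop :=
  ∀ S ⊆ T, ∀ m : ℕ, (∀ Q : Finset V, ↑Q ⊆ S → G.IsClique Q → Q.card ≤ m) →
    ∃ c : V → ℕ, (∀ x ∈ S, c x < m) ∧ ∀ x ∈ S, ∀ y ∈ S, G.Adj x y → c x ≠ c y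

/-- The vertex set `A ∪ B ∪ C` splits into a part containing `A` with cliques of size at most `k`
and a part containing `B` with cliques of size at most `l`. -/
def HasCliqueSplit {V : Type*} (G : SimpleGraph V) (A B C : Set V) (k l : ℕ) : Prop :=
  ∃ P : Set V, A ⊆ P ∧ Disjoint B P ∧
    (∀ Q : Finset V, ↑Q ⊆ A ∪ B ∪ C → ↑Q ⊆ P → G.IsClique Q → Q.card ≤ k) ∧
    (∀ Q : Finset V, ↑Q ⊆ A ∪ B ∪ C → Disjoint ↑Q P → G.IsClique Q → Q.card ≤ l)

theorem IsPerfect.colorable {V : Type*} [Finite V] {G : SimpleGraph V} (h : IsPerfect G)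
    (m : ℕ) (hm : ∀ Q : Finset V, G.IsClique Q → Q.card ≤ m) : G.Colorable m := by
  obtain ⟨Q, hQ⟩ := (G.induce Set.univ).exists_isNClique_cliqueNum
  have hle : (G.induce Set.univ).cliqueNum ≤ m := by
    rw [← hQ.card_eq, ← Finset.card_map (Function.Embedding.subtype _)]
    apply hm
    have := hQ.isClique
    intro x hx y hy hxy
    simp only [Finset.coe_map, Set.mem_image, Finset.mem_coe] at hx hy
    obtain ⟨x, hx, rfl⟩ := hx
    obtain ⟨y, hy, rfl⟩ := hy
    exact this hx hy (fun e => hxy (by rw [e]))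
  have hc : (G.induce Set.univ).Colorable m := by
    rw [← chromaticNumber_le_iff_colorable, ← h Set.univ]
    exact_mod_cast hle
  exact hc.of_hom (G.induceUnivIso.symm.toHom)

theorem isPerfect_of_colorable_cliqueNum {V : Type*} [Finite V] {G : SimpleGraph V}
    (h : ∀ S : Set V, (G.induce S).Colorable (G.induce S).cliqueNum) : IsPerfect G := by
  intro S
  apply le_antisymm
  · exact (G.induce S).cliqueNum_le_chromaticNumber
  · exact chromaticNumber_le_iff_colorable.mpr (h S)

theorem MinimallyImperfect.hereditarilyColorable {V : Type*} [Finite V] {G : SimpleGraph V}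
    (h : MinimallyImperfect G) {T : Set V} (hT : T ≠ Set.univ) :
    HereditarilyColorable G T := by
  classical
  intro S hS m hm
  have hS' : S ≠ Set.univ := fun e => hT (Set.univ_subset_iff.mp (e ▸ hS))
  obtain ⟨c⟩ := (h.2 S hS').colorable m (by
    intro Q hQ
    rw [← Finset.card_map (Function.Embedding.subtype _)]
    apply hm
    · intro x hx
      simp only [Finset.coe_map, Set.mem_image] at hx
      obtain ⟨y, _, rfl⟩ := hx
      exact y.2
    · intro x hx y hy hxy
      simp only [Finset.coe_map, Set.mem_image, Finset.mem_coe] at hx hy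
      obtain ⟨x, hx, rfl⟩ := hx
      obtain ⟨y, hy, rfl⟩ := hy
      exact hQ hx hy (fun e => hxy (by rw [e])))
  refine ⟨fun x => if hx : x ∈ S then c ⟨x, hx⟩ else 0, ?_, ?_⟩
  · intro x hx
    simp [hx]
  · intro x hx y hy hxy
    simp only [hx, hy, dif_pos]
    intro e
    exact c.valid (v := ⟨x, hx⟩) (w := ⟨y, hy⟩) hxy (Fin.ext e)

theorem MinimallyImperfect.not_colorable_cliqueNum {V : Type*} [Finite V] {G : SimpleGraph V}
    (h : MinimallyImperfect G) : ¬ G.Colorable G.cliqueNum := by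
  intro hc
  apply h.1
  apply isPerfect_of_colorable_cliqueNum
  intro S
  by_cases hS : S = Set.univ
  · subst hS
    obtain ⟨Q, hQ⟩ := G.exists_isNClique_cliqueNum
    have hle : G.cliqueNum ≤ (G.induce Set.univ).cliqueNum := by
      have hQ' : (G.induce Set.univ).IsClique
          (Q.map G.induceUnivIso.symm.toEquiv.toEmbedding : Finset _) := by
        intro x hx y hy hxy
        simp only [Finset.coe_map, Set.mem_image, Finset.mem_coe] at hx hy
        obtain ⟨x, hx, rfl⟩ := hx
        obtain ⟨y, hy, rfl⟩ := hy
        exact hQ.isClique hx hy (fun e => hxy (Subtype.ext e))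
      have := hQ'.card_le_cliqueNum
      rwa [Finset.card_map, hQ.card_eq] at this
    exact (hc.of_hom G.induceUnivIso.toHom).mono hle
  · exact (h.2 S hS).colorable _ fun Q hQ => hQ.card_le_cliqueNum

/-- Weighted form of the replication lemma for perfect graphs. -/
theorem HereditarilyColorable.exists_weighted_coloring {V : Type*} [Finite V]
    {G : SimpleGraph V} {T : Set V} (hT : HereditarilyColorable G T) (f : V → ℕ) (m : ℕ)
    (hf : ∀ Q : Finset V, ↑Q ⊆ T → G.IsClique Q → ∑ x ∈ Q, f x ≤ m) :
    ∃ F : V → Finset ℕ, (∀ x ∈ T, (F x).card = f x ∧ F x ⊆ Finset.range m) ∧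
      ∀ x ∈ T, ∀ y ∈ T, G.Adj x y → Disjoint (F x) (F y) := by
  classical
  have := Fintype.ofFinite V
  induction hN : ∑ x, f x using Nat.strong_induction_on generalizing f m with
  | _ N ih =>
  subst hN
  by_cases hone : ∀ x ∈ T, f x ≤ 1
  · obtain ⟨c, hcm, hc⟩ := hT {x ∈ T | f x = 1} (fun x hx => hx.1) m (by
      intro Q hQ hQc
      have := hf Q (fun x hx => (hQ hx).1) hQc
      rwa [Finset.sum_congr rfl (fun x hx => (hQ hx).2), Finset.sum_const, smul_eq_mul,
        mul_one] at this)
    refine ⟨fun x => if f x = 1 then {c x} else ∅, ?_, ?_⟩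
    · intro x hx
      by_cases h1 : f x = 1
      · simpa [h1] using hcm x ⟨hx, h1⟩
      · have := hone x hx
        simp only [h1, if_false, Finset.card_empty, Finset.empty_subset, and_true]
        omega
    · intro x hx y hy hxy
      by_cases h1 : f x = 1 <;> by_cases h2 : f y = 1 <;> simp [h1, h2]
      exact hc x ⟨hx, h1⟩ y ⟨hy, h2⟩ hxy
  push Not at hone
  obtain ⟨v, hvT, hv⟩ := hone
  set f' : V → ℕ := fun x => if x = v then f x - 1 else f x with hf'
  have hf'le : ∀ x, f' x ≤ f x := by
    intro x
    simp only [hf']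
    split_ifs <;> omega
  have hf'v : f' v + 1 = f v := by simp only [hf', if_true]; omega
  have hlt : ∑ x, f' x < ∑ x, f x :=
    Finset.sum_lt_sum (fun x _ => hf'le x) ⟨v, Finset.mem_univ v, by omega⟩
  obtain ⟨F, hF, hFd⟩ := ih _ hlt f' m
    (fun Q hQ hQc => (Finset.sum_le_sum fun x _ => hf'le x).trans (hf Q hQ hQc)) rfl
  obtain ⟨i, hi⟩ : (F v).Nonempty := by
    rw [← Finset.card_pos, (hF v hvT).1]
    omega
  have him : i < m := Finset.mem_range.mp ((hF v hvT).2 hi)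
  have hpos : ∀ x ∈ T, i ∈ F x → 1 ≤ f' x := by
    intro x hx hix
    rw [← (hF x hx).1]
    exact Finset.card_pos.mpr ⟨i, hix⟩
  set g : V → ℕ := fun x => if x ≠ v ∧ x ∈ T ∧ i ∈ F x then f' x - 1 else f' x with hg
  have hgle : ∀ x, g x ≤ f' x := by
    intro x
    simp only [hg]
    split_ifs <;> omega
  have hgsum : ∑ x, g x < ∑ x, f x :=
    (Finset.sum_le_sum fun x _ => hgle x).trans_lt hlt
  have hgc : ∀ Q : Finset V, ↑Q ⊆ T → G.IsClique Q → ∑ x ∈ Q, g x ≤ m - 1 := by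
    intro Q hQ hQc
    by_cases hvQ : v ∈ Q
    · have h1 : ∑ x ∈ Q, g x < ∑ x ∈ Q, f x :=
        Finset.sum_lt_sum (fun x _ => (hgle x).trans (hf'le x)) ⟨v, hvQ, by
          have := hgle v
          omega⟩
      have := hf Q hQ hQc
      omega
    by_cases hex : ∃ x ∈ Q, i ∈ F x
    · obtain ⟨x, hxQ, hix⟩ := hex
      have h1 : ∑ x ∈ Q, g x < ∑ x ∈ Q, f x :=
        Finset.sum_lt_sum (fun x _ => (hgle x).trans (hf'le x)) ⟨x, hxQ, by
          have h2 := hpos x (hQ hxQ) hix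
          have h3 := hf'le x
          have h4 : g x = f' x - 1 :=
            if_pos ⟨fun e => hvQ (e ▸ hxQ), hQ hxQ, hix⟩
          omega⟩
      have := hf Q hQ hQc
      omega
    · push Not at hex
      have hcard : (Q.biUnion F).card = ∑ x ∈ Q, f' x := by
        rw [Finset.card_biUnion]
        · exact Finset.sum_congr rfl fun x hx => (hF x (hQ hx)).1
        · intro x hx y hy hxy
          exact hFd x (hQ hx) y (hQ hy) (hQc hx hy hxy)
      have hsub : Q.biUnion F ⊆ (Finset.range m).erase i := by
        intro j hj
        obtain ⟨x, hx, hjx⟩ := Finset.mem_biUnion.mp hj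
        exact Finset.mem_erase.mpr ⟨fun e => hex x hx (e ▸ hjx), (hF x (hQ hx)).2 hjx⟩
      have h1 := Finset.card_le_card hsub
      rw [hcard, Finset.card_erase_of_mem (Finset.mem_range.mpr him), Finset.card_range] at h1
      exact (Finset.sum_le_sum fun x _ => hgle x).trans h1
  obtain ⟨H, hH, hHd⟩ := ih _ hgsum g (m - 1) hgc rfl
  have hnot : ∀ x ∈ T, m - 1 ∉ H x := fun x hx hmem => by
    have := Finset.mem_range.mp ((hH x hx).2 hmem)
    omega
  refine ⟨fun x => if i ∈ F x then insert (m - 1) (H x) else H x, ?_, ?_⟩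
  · intro x hx
    have hHx : H x ⊆ Finset.range m :=
      (hH x hx).2.trans (Finset.range_mono (Nat.sub_le m 1))
    by_cases hix : i ∈ F x
    · simp only [hix, if_true]
      refine ⟨?_, Finset.insert_subset (Finset.mem_range.mpr (by omega)) hHx⟩
      rw [Finset.card_insert_of_notMem (hnot x hx), (hH x hx).1]
      have := hpos x hx hix
      by_cases hxv : x = v
      · subst hxv
        simpa [hg] using hf'v
      · simp only [hg, hf', hxv, ne_eq, not_false_eq_true, hx, hix, and_self, if_true,
          if_false] at this ⊢
        omega
    · simp only [hix, if_false]
      refine ⟨?_, hHx⟩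
      rw [(hH x hx).1]
      have hxv : x ≠ v := fun e => hix (e ▸ hi)
      simp [hg, hf', hix, hxv]
  · intro x hx y hy hxy
    have hd := hHd x hx y hy hxy
    have h1 := hnot x hx
    have h2 := hnot y hy
    have h3 : i ∈ F x → i ∉ F y := fun h h' =>
      Finset.disjoint_left.mp (hFd x hx y hy hxy) h h'
    by_cases hix : i ∈ F x <;> by_cases hiy : i ∈ F y <;>
      simp_all [Finset.disjoint_insert_left, Finset.disjoint_insert_right]

theorem hasCliqueSplit_of_coloring {V : Type*} [Finite V] {G : SimpleGraph V} {A B C : Set V}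
    {c : V → ℕ} {X Y : Finset ℕ} {k l : ℕ}
    (hcm : ∀ x ∈ A ∪ B ∪ C, c x < k + l)
    (hc : ∀ x ∈ A ∪ B ∪ C, ∀ y ∈ A ∪ B ∪ C, G.Adj x y → c x ≠ c y)
    (hA : ∀ x ∈ A, c x ∈ X) (hB : ∀ x ∈ B, c x ∈ Y) (hX : X ⊆ Finset.range (k + l))
    (hXY : Disjoint X Y) (hXk : X.card ≤ k) (hYl : Y.card ≤ l) :
    HasCliqueSplit G A B C k l := by
  classical
  have hXsub : X ⊆ Finset.range (k + l) \ Y := fun i hi =>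
    Finset.mem_sdiff.mpr ⟨hX hi, Finset.disjoint_left.mp hXY hi⟩
  have hk : k ≤ (Finset.range (k + l) \ Y).card := by
    have := Finset.le_card_sdiff Y (Finset.range (k + l))
    rw [Finset.card_range] at this
    omega
  obtain ⟨K, hXK, hK, hKk⟩ := Finset.exists_subsuperset_card_eq hXsub hXk hk
  have hinj : ∀ Q : Finset V, ↑Q ⊆ A ∪ B ∪ C → G.IsClique Q → Set.InjOn c Q := by
    intro Q hQ hQc x hx y hy hxy
    by_contra hne
    exact hc x (hQ hx) y (hQ hy) (hQc hx hy hne) hxy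
  refine ⟨{x | c x ∈ K}, fun x hx => hXK (hA x hx), ?_, ?_, ?_⟩
  · rw [Set.disjoint_left]
    intro x hx hxK
    exact (Finset.mem_sdiff.mp (hK hxK)).2 (hB x hx)
  · intro Q hQ hQP hQc
    rw [← hKk, ← Finset.card_image_of_injOn (hinj Q hQ hQc)]
    exact Finset.card_le_card (Finset.image_subset_iff.mpr fun x hx => hQP hx)
  · intro Q hQ hQP hQc
    have h1 : Q.image c ⊆ Finset.range (k + l) \ K := Finset.image_subset_iff.mpr fun x hx =>
      Finset.mem_sdiff.mpr ⟨Finset.mem_range.mpr (hcm x (hQ hx)),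
        fun h => Set.disjoint_left.mp hQP hx h⟩
    have h2 := Finset.card_le_card h1
    rw [Finset.card_image_of_injOn (hinj Q hQ hQc),
      Finset.card_sdiff_of_subset (hK.trans Finset.sdiff_subset), Finset.card_range] at h2
    omega

/-- Weights for which `A` and `B` contain cliques of weights `k` and `l` force a clique split,
provided the vertices of weight greater than one have no neighbours in `C`. -/
theorem hasCliqueSplit_of_weights {V : Type*} [Finite V] {G : SimpleGraph V} {A B C : Set V}
    (hT : HereditarilyColorable G (A ∪ B ∪ C)) (hAB : ∀ a ∈ A, ∀ b ∈ B, G.Adj a b)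
    {k l : ℕ} (hω : ∀ Q : Finset V, G.IsClique Q → Q.card ≤ k + l) {f : V → ℕ}
    (hf1 : ∀ x, 1 ≤ f x) (hfC : ∀ x ∈ A ∪ B ∪ C, f x ≠ 1 → x ∉ C ∧ ∀ y ∈ C, ¬ G.Adj x y)
    (hfA : ∀ Q : Finset V, ↑Q ⊆ A → G.IsClique Q → ∑ x ∈ Q, f x ≤ k)
    (hfB : ∀ Q : Finset V, ↑Q ⊆ B → G.IsClique Q → ∑ x ∈ Q, f x ≤ l)
    (hA : ∃ Q : Finset V, ↑Q ⊆ A ∧ G.IsClique Q ∧ ∑ x ∈ Q, f x = k)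
    (hB : ∃ Q : Finset V, ↑Q ⊆ B ∧ G.IsClique Q ∧ ∑ x ∈ Q, f x = l) :
    HasCliqueSplit G A B C k l := by
  classical
  have := Fintype.ofFinite V
  have hAT : A ⊆ A ∪ B ∪ C := fun x hx => Or.inl (Or.inl hx)
  have hBT : B ⊆ A ∪ B ∪ C := fun x hx => Or.inl (Or.inr hx)
  have hf : ∀ Q : Finset V, ↑Q ⊆ A ∪ B ∪ C → G.IsClique Q → ∑ x ∈ Q, f x ≤ k + l := by
    intro Q hQ hQc
    by_cases hex : ∃ x ∈ Q, f x ≠ 1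
    · obtain ⟨x, hxQ, hx⟩ := hex
      obtain ⟨hxC, hxn⟩ := hfC x (hQ hxQ) hx
      have hQB : ∀ y ∈ Q, y ∉ A → y ∈ B := by
        intro y hy hyA
        rcases hQ hy with (h | h) | h
        · exact absurd h hyA
        · exact h
        · exact absurd (hQc hxQ hy fun e => hxC (e ▸ h)) (hxn y h)
      rw [← Finset.sum_filter_add_sum_filter_not Q (· ∈ A)]
      apply add_le_add
      · exact hfA _ (fun y hy => (Finset.mem_filter.mp hy).2)
          (hQc.subset (Finset.coe_subset.mpr (Finset.filter_subset _ _)))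
      · exact hfB _ (fun y hy => hQB y (Finset.mem_filter.mp hy).1 (Finset.mem_filter.mp hy).2)
          (hQc.subset (Finset.coe_subset.mpr (Finset.filter_subset _ _)))
    · push Not at hex
      rw [Finset.sum_congr rfl hex, Finset.sum_const, smul_eq_mul, mul_one]
      exact hω Q hQc
  obtain ⟨F, hF, hFd⟩ := hT.exists_weighted_coloring f (k + l) hf
  have hne : ∀ x, ∃ i, x ∈ A ∪ B ∪ C → i ∈ F x := by
    intro x
    by_cases hx : x ∈ A ∪ B ∪ C
    · obtain ⟨i, hi⟩ := Finset.card_pos.mp ((hf1 x).trans_eq (hF x hx).1.symm)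
      exact ⟨i, fun _ => hi⟩
    · exact ⟨0, fun h => absurd h hx⟩
  choose c hc using hne
  set X : Finset ℕ := (Finset.univ.filter (· ∈ A)).biUnion F with hX
  set Y : Finset ℕ := (Finset.univ.filter (· ∈ B)).biUnion F with hY
  have hcard : ∀ Q : Finset V, ↑Q ⊆ A ∪ B ∪ C → G.IsClique Q →
      (Q.biUnion F).card = ∑ x ∈ Q, f x := by
    intro Q hQ hQc
    rw [Finset.card_biUnion]
    · exact Finset.sum_congr rfl fun x hx => (hF x (hQ hx)).1
    · intro x hx y hy hxy
      exact hFd x (hQ hx) y (hQ hy) (hQc hx hy hxy)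
  have hXr : X ⊆ Finset.range (k + l) := Finset.biUnion_subset.mpr fun x hx =>
    (hF x (hAT (Finset.mem_filter.mp hx).2)).2
  have hYr : Y ⊆ Finset.range (k + l) := Finset.biUnion_subset.mpr fun x hx =>
    (hF x (hBT (Finset.mem_filter.mp hx).2)).2
  have hXY : Disjoint X Y := by
    simp only [hX, hY, Finset.disjoint_biUnion_left, Finset.disjoint_biUnion_right,
      Finset.mem_filter, Finset.mem_univ, true_and]
    exact fun a ha b hb => hFd _ (hAT ‹_›) _ (hBT ‹_›) (hAB _ ‹_› _ ‹_›)
  have hXYle : X.card + Y.card ≤ k + l := by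
    rw [← Finset.card_union_of_disjoint hXY]
    simpa using Finset.card_le_card (Finset.union_subset hXr hYr)
  have hkX : k ≤ X.card := by
    obtain ⟨Q, hQA, hQc, hQk⟩ := hA
    rw [← hQk, ← hcard Q (hQA.trans hAT) hQc]
    exact Finset.card_le_card (Finset.biUnion_subset_biUnion_of_subset_left _
      fun x hx => Finset.mem_filter.mpr ⟨Finset.mem_univ x, hQA hx⟩)
  have hlY : l ≤ Y.card := by
    obtain ⟨Q, hQB, hQc, hQl⟩ := hB
    rw [← hQl, ← hcard Q (hQB.trans hBT) hQc]
    exact Finset.card_le_card (Finset.biUnion_subset_biUnion_of_subset_left _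
      fun x hx => Finset.mem_filter.mpr ⟨Finset.mem_univ x, hQB hx⟩)
  refine hasCliqueSplit_of_coloring (c := c) (X := X) (Y := Y) ?_ ?_ ?_ ?_ hXr hXY
    (by omega) (by omega)
  · exact fun x hx => Finset.mem_range.mp ((hF x hx).2 (hc x hx))
  · exact fun x hx y hy hxy e =>
      Finset.disjoint_left.mp (hFd x hx y hy hxy) (hc x hx) (e ▸ hc y hy)
  · exact fun x hx => Finset.mem_biUnion.mpr
      ⟨x, Finset.mem_filter.mpr ⟨Finset.mem_univ x, hx⟩, hc x (hAT hx)⟩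
  · exact fun x hx => Finset.mem_biUnion.mpr
      ⟨x, Finset.mem_filter.mpr ⟨Finset.mem_univ x, hx⟩, hc x (hBT hx)⟩

theorem exists_maximum_card_of_finset {V : Type*} [Finite V] {p : Finset V → Prop}
    (h : ∃ Q, p Q) : ∃ Q, p Q ∧ ∀ R, p R → R.card ≤ Q.card := by
  obtain ⟨Q, hQ, hmax⟩ := (Set.toFinite {Q | p Q}).exists_maximalFor Finset.card _ h
  refine ⟨Q, hQ, fun R hR => ?_⟩
  by_contra! hlt
  exact absurd (hmax hR hlt.le) (by simpa using hlt)

/-- Raising the weight of a single vertex `u ∈ A` makes the maximum clique weight in `A` equal to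
any prescribed bound on the clique sizes. -/
theorem exists_weight_of_clique_bound {V : Type*} [Finite V] {G : SimpleGraph V} {A : Set V}
    {u : V} (hu : u ∈ A) {k : ℕ} (hk : ∀ Q : Finset V, ↑Q ⊆ A → G.IsClique Q → Q.card ≤ k) :
    ∃ f : V → ℕ, (∀ x, 1 ≤ f x) ∧ (∀ x, x ≠ u → f x = 1) ∧
      (∀ Q : Finset V, ↑Q ⊆ A → G.IsClique Q → ∑ x ∈ Q, f x ≤ k) ∧
      ∃ Q : Finset V, ↑Q ⊆ A ∧ G.IsClique Q ∧ ∑ x ∈ Q, f x = k := by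
  classical
  obtain ⟨M, ⟨hMA, hMc, huM⟩, hmax⟩ := exists_maximum_card_of_finset
    (p := fun Q : Finset V => ↑Q ⊆ A ∧ G.IsClique Q ∧ u ∈ Q) ⟨{u}, by simpa using hu⟩
  have hMk := hk M hMA hMc
  have hsum : ∀ Q : Finset V, ∑ x ∈ Q, (1 + if x = u then k - M.card else 0) =
      Q.card + if u ∈ Q then k - M.card else 0 := by
    intro Q
    rw [Finset.sum_add_distrib, Finset.sum_ite_eq']
    simp
  refine ⟨fun x => 1 + if x = u then k - M.card else 0, fun x => Nat.le_add_right _ _,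
    fun x hx => by simp [hx], fun Q hQA hQc => ?_, M, hMA, hMc, ?_⟩
  · rw [hsum]
    split_ifs with huQ
    · have := hmax Q ⟨hQA, hQc, huQ⟩
      omega
    · exact hk Q hQA hQc
  · rw [hsum, if_pos huM]
    omega

theorem IsSkewPartition.not_hasCliqueSplit {V : Type*} [Finite V] {G : SimpleGraph V}
    {A B C D : Set V} (hsp : IsSkewPartition G A B C D) (hmi : MinimallyImperfect G) {k l : ℕ}
    (hkl : k + l = G.cliqueNum) (hC : HasCliqueSplit G A B C k l) :
    ¬ HasCliqueSplit G A B D k l := by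
  classical
  rintro ⟨P₂, hA₂, hB₂, hk₂, hl₂⟩
  obtain ⟨P₁, hA₁, hB₁, hk₁, hl₁⟩ := hC
  obtain ⟨⟨a, ha⟩, ⟨b, hb⟩, -, -, huniv, -, -, -, -, -, hCD, -, hnCD⟩ := hsp
  rw [Set.disjoint_left] at hB₁ hB₂ hCD
  have hcov : ∀ x, ((x ∈ A ∨ x ∈ B) ∨ x ∈ C) ∨ x ∈ D := fun x => by
    have : x ∈ A ∪ B ∪ C ∪ D := huniv ▸ Set.mem_univ x
    exact this
  have hside : ∀ Q : Finset V, G.IsClique Q → ↑Q ⊆ A ∪ B ∪ C ∨ ↑Q ⊆ A ∪ B ∪ D := by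
    intro Q hQc
    by_contra! h
    obtain ⟨h₁, h₂⟩ := h
    obtain ⟨x, hx, hxn⟩ := Set.not_subset.mp h₁
    obtain ⟨y, hy, hyn⟩ := Set.not_subset.mp h₂
    have hxD : x ∈ D := (hcov x).resolve_left hxn
    have hyC : y ∈ C := by
      rcases hcov y with (h | h) | h
      · exact absurd (Or.inl h) hyn
      · exact h
      · exact absurd (Or.inr h) hyn
    exact hnCD y hyC x hxD (hQc hy hx fun e => hCD (e ▸ hyC) hxD)
  set P : Set V := {x | (x ∈ A ∪ B ∪ C → x ∈ P₁) ∧ (x ∈ A ∪ B ∪ D → x ∈ P₂)} with hP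
  have haP : a ∈ P := ⟨fun _ => hA₁ ha, fun _ => hA₂ ha⟩
  have hbP : b ∉ P := fun h => hB₁ hb (h.1 (Or.inl (Or.inr hb)))
  obtain ⟨c₁, hc₁, hp₁⟩ := hmi.hereditarilyColorable (T := P)
    (fun e => hbP (e ▸ Set.mem_univ b)) P subset_rfl k (by
      intro Q hQP hQc
      rcases hside Q hQc with h | h
      · exact hk₁ Q h (fun x hx => (hQP hx).1 (h hx)) hQc
      · exact hk₂ Q h (fun x hx => (hQP hx).2 (h hx)) hQc)
  have hPc₁ : ∀ x, x ∉ P → x ∈ A ∪ B ∪ C → x ∉ P₁ := by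
    intro x hx hxC hx₁
    refine hx ⟨fun _ => hx₁, fun hxD => ?_⟩
    rcases hxC with (h | h) | h
    · exact hA₂ h
    · exact absurd hx₁ (hB₁ h)
    · rcases hxD with (h' | h') | h'
      · exact hA₂ h'
      · exact absurd hx₁ (hB₁ h')
      · exact absurd h' (hCD h)
  have hPc₂ : ∀ x, x ∉ P → x ∈ A ∪ B ∪ D → x ∉ P₂ := by
    intro x hx hxD hx₂
    refine hx ⟨fun hxC => ?_, fun _ => hx₂⟩
    rcases hxD with (h | h) | h
    · exact hA₁ h
    · exact absurd hx₂ (hB₂ h)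
    · rcases hxC with (h' | h') | h'
      · exact hA₁ h'
      · exact absurd hx₂ (hB₂ h')
      · exact absurd h (hCD h')
  obtain ⟨c₂, hc₂, hp₂⟩ := hmi.hereditarilyColorable (T := Pᶜ)
    (fun e => (e ▸ Set.mem_univ a : a ∈ Pᶜ) haP) Pᶜ subset_rfl l (by
      intro Q hQP hQc
      rcases hside Q hQc with h | h
      · exact hl₁ Q h (Set.disjoint_left.mpr fun x hx => hPc₁ x (hQP hx) (h hx)) hQc
      · exact hl₂ Q h (Set.disjoint_left.mpr fun x hx => hPc₂ x (hQP hx) (h hx)) hQc)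
  apply hmi.not_colorable_cliqueNum
  rw [← hkl]
  refine ⟨Coloring.mk (fun x => if h : x ∈ P then (⟨c₁ x, by have := hc₁ x h; omega⟩ : Fin (k + l))
    else ⟨k + c₂ x, by have := hc₂ x h; omega⟩) ?_⟩
  intro x y hxy
  by_cases hx : x ∈ P <;> by_cases hy : y ∈ P <;>
    simp only [hx, hy, dif_pos, dif_neg, not_false_eq_true, ne_eq, Fin.mk.injEq]
  · exact hp₁ x hx y hy hxy
  · have := hc₁ x hx
    omega
  · have := hc₁ y hy
    omega
  · have := hp₂ x hx y hy hxy
    omega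

/-- In a minimally imperfect graph with skew partition `A, B, C, D`, if some
`u ∈ A` has no neighbor in `C`, then every vertex of `A` has a neighbor in `D` and
every vertex of `B` has a neighbor in `C`. -/
theorem skewPartition_neighbor_lemma {V : Type*} [Fintype V] (G : SimpleGraph V)
    (A B C D : Set V) (hmi : MinimallyImperfect G)
    (hsp : IsSkewPartition G A B C D)
    (u : V) (hu : u ∈ A) (huC : ∀ c ∈ C, ¬ G.Adj u c) :
    (∀ a ∈ A, ∃ d ∈ D, G.Adj a d) ∧ (∀ b ∈ B, ∃ c ∈ C, G.Adj b c) := by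
  classical
  have hsplit := fun k l => hsp.not_hasCliqueSplit hmi (k := k) (l := l)
  obtain ⟨-, -, ⟨c₀, hc₀⟩, ⟨d₀, hd₀⟩, -, dAB, dAC, dAD, dBC, dBD, dCD, hAB, -⟩ := hsp
  rw [Set.disjoint_left] at dAB dAC dAD dBC dBD dCD
  have hω : ∀ Q : Finset V, G.IsClique Q → Q.card ≤ G.cliqueNum :=
    fun Q hQ => hQ.card_le_cliqueNum
  have hTC : HereditarilyColorable G (A ∪ B ∪ C) := hmi.hereditarilyColorable fun e => by
    rcases (e ▸ Set.mem_univ d₀ : d₀ ∈ A ∪ B ∪ C) with (h | h) | h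
    exacts [dAD h hd₀, dBD h hd₀, dCD h hd₀]
  have hTD : HereditarilyColorable G (A ∪ B ∪ D) := hmi.hereditarilyColorable fun e => by
    rcases (e ▸ Set.mem_univ c₀ : c₀ ∈ A ∪ B ∪ D) with (h | h) | h
    exacts [dAC h hc₀, dBC h hc₀, dCD hc₀ h]
  constructor
  · intro w hw
    by_contra! hwD
    obtain ⟨M, ⟨hMB, hMc⟩, hmax⟩ := exists_maximum_card_of_finset
      (p := fun Q : Finset V => ↑Q ⊆ B ∧ G.IsClique Q) ⟨∅, by simp⟩
    have hMω := hω M hMc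
    have hAk : ∀ Q : Finset V, ↑Q ⊆ A → G.IsClique Q → Q.card ≤ G.cliqueNum - M.card := by
      intro Q hQA hQc
      have hdis : Disjoint Q M := Finset.disjoint_left.mpr fun x hx hxM => dAB (hQA hx) (hMB hxM)
      have h : G.IsClique (Q ∪ M : Finset V) := by
        rw [Finset.coe_union]
        rintro x (hx | hx) y (hy | hy) hxy
        · exact hQc hx hy hxy
        · exact hAB x (hQA hx) y (hMB hy)
        · exact (hAB y (hQA hy) x (hMB hx)).symm
        · exact hMc hx hy hxy
      have := hω _ h
      rw [Finset.card_union_of_disjoint hdis] at this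
      omega
    have key : ∀ (E : Set V) (v : V), v ∈ A → v ∉ E → (∀ e ∈ E, ¬ G.Adj v e) →
        HereditarilyColorable G (A ∪ B ∪ E) →
        HasCliqueSplit G A B E (G.cliqueNum - M.card) M.card := by
      intro E v hv hvE hvn hT
      obtain ⟨f, hf1, hfv, hfA, hfA'⟩ := exists_weight_of_clique_bound hv hAk
      have hfB : ∀ Q : Finset V, ↑Q ⊆ B → ∑ x ∈ Q, f x = Q.card := by
        intro Q hQ
        rw [Finset.sum_congr rfl fun x hx => hfv x fun e => dAB hv (e ▸ hQ hx)]
        simp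
      refine hasCliqueSplit_of_weights hT hAB (fun Q hQ => (hω Q hQ).trans (by omega)) hf1
        ?_ hfA ?_ hfA' ⟨M, hMB, hMc, hfB M hMB⟩
      · intro x _ hx
        obtain rfl : x = v := by_contra fun h => hx (hfv x h)
        exact ⟨hvE, hvn⟩
      · intro Q hQ hQc
        rw [hfB Q hQ]
        exact hmax Q ⟨hQ, hQc⟩
    exact hsplit _ _ (by omega) (key C u hu (dAC hu) huC hTC) (key D w hw (dAD hw) hwD hTD)
  · intro b hb
    by_contra! hbC
    obtain ⟨c, hcm, hc⟩ := hTD _ subset_rfl G.cliqueNum fun Q _ hQ => hω Q hQ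
    set X : Finset ℕ := (Finset.univ.filter (· ∈ A)).image c with hX
    set Y : Finset ℕ := (Finset.univ.filter (· ∈ B)).image c with hY
    have hXr : X ⊆ Finset.range G.cliqueNum := Finset.image_subset_iff.mpr fun x hx =>
      Finset.mem_range.mpr (hcm x (Or.inl (Or.inl (Finset.mem_filter.mp hx).2)))
    have hYr : Y ⊆ Finset.range G.cliqueNum := Finset.image_subset_iff.mpr fun x hx =>
      Finset.mem_range.mpr (hcm x (Or.inl (Or.inr (Finset.mem_filter.mp hx).2)))
    have hXY : Disjoint X Y := by
      rw [Finset.disjoint_left]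
      intro i hi hi'
      obtain ⟨x, hx, rfl⟩ := Finset.mem_image.mp hi
      obtain ⟨y, hy, hxy⟩ := Finset.mem_image.mp hi'
      have hxA := (Finset.mem_filter.mp hx).2
      have hyB := (Finset.mem_filter.mp hy).2
      exact hc x (Or.inl (Or.inl hxA)) y (Or.inl (Or.inr hyB)) (hAB x hxA y hyB) hxy.symm
    have hcard : X.card + Y.card ≤ G.cliqueNum := by
      rw [← Finset.card_union_of_disjoint hXY]
      simpa using Finset.card_le_card (Finset.union_subset hXr hYr)
    obtain ⟨l, hl⟩ := Nat.exists_eq_add_of_le ((Nat.le_add_right _ _).trans hcard)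
    have hD : HasCliqueSplit G A B D X.card l := by
      refine hasCliqueSplit_of_coloring (c := c) (X := X) (Y := Y) ?_ hc ?_ ?_ ?_ hXY le_rfl
        (by omega)
      · rwa [← hl]
      · exact fun x hx => Finset.mem_image_of_mem c (by simpa using hx)
      · exact fun x hx => Finset.mem_image_of_mem c (by simpa using hx)
      · rwa [← hl]
    refine hsplit _ _ hl.symm ?_ hD
    obtain ⟨P, hAP, hBP, hk, hl'⟩ := hD
    obtain ⟨f, hf1, hfu, hfA, QA, hQA, hQAc, hQAk⟩ := exists_weight_of_clique_bound hu
      fun Q hQ hQc => hk Q (fun x hx => Or.inl (Or.inl (hQ hx))) (hQ.trans hAP) hQc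
    obtain ⟨g, hg1, hgb, hgB, QB, hQB, hQBc, hQBl⟩ := exists_weight_of_clique_bound hb
      fun Q hQ hQc => hl' Q (fun x hx => Or.inl (Or.inr (hQ hx))) (hBP.mono_left hQ) hQc
    have hsA : ∀ Q : Finset V, ↑Q ⊆ A →
        ∑ x ∈ Q, (if x ∈ A then f x else g x) = ∑ x ∈ Q, f x :=
      fun Q hQ => Finset.sum_congr rfl fun x hx => if_pos (hQ hx)
    have hsB : ∀ Q : Finset V, ↑Q ⊆ B →
        ∑ x ∈ Q, (if x ∈ A then f x else g x) = ∑ x ∈ Q, g x :=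
      fun Q hQ => Finset.sum_congr rfl fun x hx => if_neg fun h => dAB h (hQ hx)
    refine hasCliqueSplit_of_weights (f := fun x => if x ∈ A then f x else g x) hTC hAB
      (fun Q hQ => (hω Q hQ).trans hl.le) ?_ ?_ ?_ ?_ ⟨QA, hQA, hQAc, (hsA QA hQA).trans hQAk⟩
      ⟨QB, hQB, hQBc, (hsB QB hQB).trans hQBl⟩
    · intro x
      split_ifs
      exacts [hf1 x, hg1 x]
    · intro x _ hx
      split_ifs at hx with h
      · obtain rfl : x = u := by_contra fun h => hx (hfu x h)
        exact ⟨dAC hu, huC⟩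
      · obtain rfl : x = b := by_contra fun h => hx (hgb x h)
        exact ⟨dBC hb, hbC⟩
    · exact fun Q hQ hQc => (hsA Q hQ).trans_le (hfA Q hQ hQc)
    · exact fun Q hQ hQc => (hsB Q hQ).trans_le (hgB Q hQ hQc)
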